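/- Let R > 0, let G̃ = G + ψ with G the standard Gaussian and ψ ∈ W^{2,1}(ℝ²), let J ∈ C⁰(ℝ²), and let 0 < s ≤ 1. For measurable u: ℝ² → [0,1] vanishing outside B_R, define 𝒫_{J,s}(u)(x) = ∬ u(ξ) G̃_s(x−ξ) J(ξ−η) G̃_s(x−η) u(η) dξ dη and 𝒫_{1,s}(u) = (u ∗ G̃_s)². Then there exists an absolute constant C > 0 such that, with ε = ‖J − 1‖_{L^∞(B_{2R})}, ‖∇(𝒫_{J,s}(u) − 𝒫_{1,s}(u))‖_{L^∞(ℝ²)} ≤ C ‖G̃‖_{L¹(ℝ²)} ‖∇G̃‖_{L¹(ℝ²)} ε / s. -/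

import Mathlib

open MeasureTheory Metric Set

noncomputable section

abbrev E2 : Type := EuclideanSpace ℝ (Fin 2)

/-- The standard Gaussian on the plane, `G x = (2π)⁻¹ exp (-|x|²/2)`. -/
def Gauss : E2 → ℝ := fun x => (2 * Real.pi)⁻¹ * Real.exp (-‖x‖ ^ 2 / 2)

/-- `g` is the weak partial derivative of `f` in the direction of the `i`-th coordinate. -/
def IsWeakPartialDeriv (i : Fin 2) (f g : E2 → ℝ) : Prop :=
  ∀ φ : E2 → ℝ, ContDiff ℝ (⊤ : ℕ∞) φ → HasCompactSupport φ →
    ∫ x, f x * fderiv ℝ φ x (EuclideanSpace.single i 1) = -∫ x, g x * φ x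

/-- The Hopkins-type bilinear intensity operator
`𝒫(u)(x) = ∬ u ξ Gs (x-ξ) J (ξ-η) Gs (x-η) u η dξ dη`. -/
def Pop (Gs J u : E2 → ℝ) (x : E2) : ℝ :=
  ∫ ξ, ∫ η, u ξ * Gs (x - ξ) * J (ξ - η) * Gs (x - η) * u η

/-- Rescaling `f_s (x) = s⁻² f (x / s)`. -/
def resc (s : ℝ) (f : E2 → ℝ) : E2 → ℝ := fun x => (s⁻¹) ^ 2 * f (s⁻¹ • x)

/-- First classical partial derivatives of the Gaussian. -/
def GaussD (i : Fin 2) (x : E2) : ℝ := fderiv ℝ Gauss x (EuclideanSpace.single i 1)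

/-- Second classical partial derivatives of the Gaussian. -/
def GaussD2 (i j : Fin 2) (x : E2) : ℝ :=
  fderiv ℝ (GaussD i) x (EuclideanSpace.single j 1)

/-- A map into a Banach space is differentiable if a separating family of functionals sees it as
`C¹` with a continuous candidate derivative. -/
lemma hasFDerivAt_of_separating {E X : Type*} [NormedAddCommGroup E] [NormedSpace ℝ E]
    [NormedAddCommGroup X] [NormedSpace ℝ X] [CompleteSpace X]
    (T : E → X) (T' : E → (E →L[ℝ] X)) (hT' : Continuous T') (S : Set (X →L[ℝ] ℝ))
    (hS : ∀ z : X, (∀ Φ ∈ S, Φ z = 0) → z = 0)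
    (hd : ∀ Φ ∈ S, ∀ x v, HasDerivAt (fun t : ℝ => Φ (T (x + t • v))) (Φ (T' x v)) 0) (x : E) :
    HasFDerivAt T (T' x) x := by
  have key : ∀ h : E, T (x + h) - T x = ∫ t in (0:ℝ)..1, T' (x + t • h) h := by
    intro h
    have hc : Continuous fun t : ℝ => T' (x + t • h) h := by fun_prop
    rw [← sub_eq_zero]
    apply hS
    intro Φ hΦ
    have h1 : Φ (∫ t in (0:ℝ)..1, T' (x + t • h) h) = ∫ t in (0:ℝ)..1, Φ (T' (x + t • h) h) :=
      (Φ.intervalIntegral_comp_comm (hc.intervalIntegrable _ _)).symm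
    have h2 : ∀ t : ℝ, HasDerivAt (fun t : ℝ => Φ (T (x + t • h))) (Φ (T' (x + t • h) h)) t := by
      intro t
      have h3 := hd Φ hΦ (x + t • h) h
      have h4 : HasDerivAt (fun r : ℝ => r - t) 1 t := (hasDerivAt_id t).sub_const t
      have h5 := HasDerivAt.scomp (h := fun r : ℝ => r - t) t
        (by rw [sub_self]; exact h3) h4
      simp only [one_smul] at h5
      refine h5.congr_of_eventuallyEq (.of_forall fun r => ?_)
      simp only [Function.comp]
      congr 2
      rw [add_assoc, ← add_smul]
      simp
    have h3 := intervalIntegral.integral_eq_sub_of_hasDerivAt (a := 0) (b := 1)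
      (fun t _ => h2 t) ((Φ.continuous.comp hc).intervalIntegrable _ _)
    rw [map_sub, map_sub, h1]
    simp only [one_smul, zero_smul, add_zero] at h3
    rw [h3, sub_self]
  rw [hasFDerivAt_iff_isLittleO_nhds_zero, Asymptotics.isLittleO_iff]
  intro c hc
  obtain ⟨δ, hδ, hball⟩ := Metric.continuous_iff.1 hT' x c hc
  filter_upwards [Metric.ball_mem_nhds (0 : E) hδ] with h hh
  have hcont : Continuous fun t : ℝ => T' (x + t • h) h := by fun_prop
  have e : T' x h = ∫ t in (0:ℝ)..1, T' x h := by simp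
  rw [key h, e, ← intervalIntegral.integral_sub (hcont.intervalIntegrable _ _)
    (continuous_const.intervalIntegrable _ _)]
  have := intervalIntegral.norm_integral_le_of_norm_le_const (a := (0:ℝ)) (b := 1)
    (C := c * ‖h‖) (f := fun t : ℝ => T' (x + t • h) h - T' x h) ?_
  · simpa using this
  · intro t ht
    rw [uIoc_of_le zero_le_one] at ht
    rw [← sub_apply]
    refine (ContinuousLinearMap.le_opNorm _ _).trans ?_
    gcongr
    have : dist (x + t • h) x < δ := by
      rw [dist_eq_norm, add_sub_cancel_left, norm_smul, Real.norm_eq_abs, abs_of_pos ht.1]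
      rw [mem_ball_zero_iff] at hh
      nlinarith [norm_nonneg h, ht.2]
    have := hball _ this
    rw [dist_eq_norm] at this
    exact this.le

/-- Reflected translates of an integrable function, as elements of `L¹`. -/
def tr (F : E2 → ℝ) (hF : Integrable F) (x : E2) : Lp ℝ 1 (volume : Measure E2) :=
  (hF.comp_sub_left x).toL1 (fun y => F (x - y))

lemma tr_coe (F : E2 → ℝ) (hF : Integrable F) (x : E2) :
    (tr F hF x : E2 → ℝ) =ᵐ[volume] fun y => F (x - y) := Integrable.coeFn_toL1 _

lemma continuous_tr (F : E2 → ℝ) (hF : Integrable F) : Continuous (tr F hF) := by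
  have hm : ∀ x : E2, MeasurePreserving
      ((⟨fun p : E2 × E2 => p.1 - p.2, by fun_prop⟩ : C(E2 × E2, E2)).curry x)
      (volume : Measure E2) volume := fun x => Measure.measurePreserving_sub_left volume x
  have := Continuous.compMeasurePreservingLp (p := 1)
    (f := fun _ : E2 => hF.toL1 F) continuous_const
    (ContinuousMap.continuous
      (⟨fun p : E2 × E2 => p.1 - p.2, by fun_prop⟩ : C(E2 × E2, E2)).curry) hm (by simp)
  exact this

lemma norm_tr (F : E2 → ℝ) (hF : Integrable F) (x : E2) : ‖tr F hF x‖ = ∫ y, |F y| := by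
  rw [tr, L1.norm_of_fun_eq_integral_norm]
  exact integral_sub_left_eq_self (fun y => |F y|) volume x

/-- Testing against a bounded continuous function. -/
def testL (φ : E2 → ℝ) (hφ : Continuous φ) (hc : HasCompactSupport φ) :
    Lp ℝ 1 (volume : Measure E2) →L[ℝ] ℝ :=
  have hb := hφ.bounded_above_of_compact_support hc
  have hi : ∀ g : Lp ℝ 1 (volume : Measure E2), Integrable (fun y => φ y * g y) := fun g =>
    (L1.integrable_coeFn g).bdd_mul hφ.aestronglyMeasurable (.of_forall hb.choose_spec)
  LinearMap.mkContinuous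
    { toFun := fun g => ∫ y, φ y * g y
      map_add' := by
        intro g h
        rw [← integral_add (hi g) (hi h)]
        apply integral_congr_ae
        filter_upwards [Lp.coeFn_add g h] with y hy
        rw [hy, Pi.add_apply]; ring
      map_smul' := by
        intro c g
        simp only [RingHom.id_apply]
        rw [← integral_smul]
        apply integral_congr_ae
        filter_upwards [Lp.coeFn_smul c g] with y hy
        rw [hy, Pi.smul_apply]; simp only [smul_eq_mul]; ring } hb.choose (by
      intro g
      simp only [LinearMap.coe_mk, AddHom.coe_mk]
      rw [L1.norm_eq_integral_norm, ← integral_const_mul]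
      refine norm_integral_le_of_norm_le ((L1.integrable_coeFn g).norm.const_mul _)
        (.of_forall fun y => ?_)
      rw [norm_mul]
      gcongr
      exact hb.choose_spec y)

lemma testL_tr (φ : E2 → ℝ) (hφ : Continuous φ) (hc : HasCompactSupport φ)
    (F : E2 → ℝ) (hF : Integrable F) (x : E2) :
    testL φ hφ hc (tr F hF x) = ∫ y, F y * φ (x - y) := by
  have : testL φ hφ hc (tr F hF x) = ∫ y, φ y * tr F hF x y := rfl
  rw [this, ← integral_sub_left_eq_self (fun y => F y * φ (x - y)) volume x]
  apply integral_congr_ae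
  filter_upwards [tr_coe F hF x] with y hy
  rw [hy, sub_sub_cancel, mul_comm]

/-- The candidate derivative. -/
def trD (D : Fin 2 → E2 → ℝ) (hD : ∀ i, Integrable (D i)) (x : E2) :
    E2 →L[ℝ] Lp ℝ 1 (volume : Measure E2) :=
  ∑ i, (EuclideanSpace.proj i : E2 →L[ℝ] ℝ).smulRight (tr (D i) (hD i) x)

lemma trD_apply (D : Fin 2 → E2 → ℝ) (hD : ∀ i, Integrable (D i)) (x v : E2) :
    trD D hD x v = ∑ i, v i • tr (D i) (hD i) x := by
  simp [trD]

lemma continuous_trD (D : Fin 2 → E2 → ℝ) (hD : ∀ i, Integrable (D i)) :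
    Continuous (trD D hD) := by
  unfold trD
  refine continuous_finsetSum _ fun i _ => ?_
  exact (ContinuousLinearMap.smulRightL ℝ E2 _ (EuclideanSpace.proj i)).continuous.comp
    (continuous_tr (D i) (hD i))

lemma norm_trD (D : Fin 2 → E2 → ℝ) (hD : ∀ i, Integrable (D i)) (x : E2) :
    ‖trD D hD x‖ ≤ ∑ i, ∫ y, |D i y| := by
  refine ContinuousLinearMap.opNorm_le_bound _
    (Finset.sum_nonneg fun i _ => integral_nonneg fun y => abs_nonneg _) fun v => ?_
  rw [trD_apply, Finset.sum_mul]
  refine norm_sum_le_of_le _ fun i _ => ?_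
  rw [norm_smul, norm_tr, mul_comm]
  gcongr
  · exact PiLp.norm_apply_le v i

lemma hasFDerivAt_tr (F : E2 → ℝ) (hF : Integrable F) (D : Fin 2 → E2 → ℝ)
    (hD : ∀ i, Integrable (D i)) (hw : ∀ i, IsWeakPartialDeriv i F (D i)) (x : E2) :
    HasFDerivAt (tr F hF) (trD D hD x) x := by
  refine hasFDerivAt_of_separating (tr F hF) (trD D hD) (continuous_trD D hD)
    {Φ | ∃ (φ : E2 → ℝ) (h : ContDiff ℝ (⊤ : ℕ∞) φ) (hc : HasCompactSupport φ),
      Φ = testL φ h.continuous hc} ?_ ?_ x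
  · intro z hz
    have : ∀ᵐ y, z y = 0 := by
      apply ae_eq_zero_of_integral_contDiff_smul_eq_zero
        (L1.integrable_coeFn z).locallyIntegrable
      intro g hg hgc
      exact hz _ ⟨g, hg, hgc, rfl⟩
    exact (Lp.eq_zero_iff_ae_eq_zero).2 this
  · rintro Φ ⟨φ, hφ, hc, rfl⟩ x v
    have hfun : (fun x => testL φ hφ.continuous hc (tr F hF x)) =
        convolution F φ (ContinuousLinearMap.lsmul ℝ ℝ) volume := by
      funext y
      rw [testL_tr]
      rfl
    have hconv := hc.hasFDerivAt_convolution_right (ContinuousLinearMap.lsmul ℝ ℝ)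
        (μ := volume) (f := F) hF.locallyIntegrable (hφ.of_le (by simp)) x
    rw [← hfun] at hconv
    have hline : HasDerivAt (fun t : ℝ => x + t • v) v 0 := by
      simpa using ((hasDerivAt_id (0:ℝ)).smul_const v).const_add x
    have h0 : x = x + (0:ℝ) • v := by simp
    have hfin := HasFDerivAt.comp_hasDerivAt_of_eq (0:ℝ) hconv hline h0
    refine hfin.congr_deriv ?_
    symm
    rw [convolution_precompR_apply _ hF.locallyIntegrable (hc.fderiv ℝ)
      (hφ.continuous_fderiv (by simp))]
    rw [trD_apply, map_sum]
    have hdφ : Continuous (fderiv ℝ φ) := hφ.continuous_fderiv (by simp)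
    have hint : ∀ w : E2, Integrable fun t => F t * fderiv ℝ φ (x - t) w := by
      intro w
      obtain ⟨M, hM⟩ := hdφ.bounded_above_of_compact_support (hc.fderiv ℝ)
      refine hF.mul_bdd (c := M * ‖w‖) (by fun_prop) (.of_forall fun t => ?_)
      exact (ContinuousLinearMap.le_opNorm _ _).trans (by gcongr; exact hM _)
    have hv : v = ∑ i, v i • EuclideanSpace.single i (1:ℝ) := by
      ext j; simp [Fin.sum_univ_two]; fin_cases j <;> simp
    have : (convolution F (fun a => fderiv ℝ φ a v) (ContinuousLinearMap.lsmul ℝ ℝ) volume x)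
        = ∑ i, v i * ∫ t, F t * fderiv ℝ φ (x - t) (EuclideanSpace.single i 1) := by
      simp_rw [← integral_const_mul]
      rw [← integral_finsetSum _ fun i _ => (hint _).const_mul _]
      apply integral_congr_ae
      refine .of_forall fun t => ?_
      simp only [ContinuousLinearMap.lsmul_apply, smul_eq_mul]
      conv_lhs => rw [hv]
      rw [map_sum, Finset.mul_sum]
      refine Finset.sum_congr rfl fun i _ => ?_
      rw [map_smul, smul_eq_mul]; ring
    rw [this]
    refine Finset.sum_congr rfl fun i _ => ?_
    rw [map_smul, smul_eq_mul, testL_tr]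
    congr 1
    have hsm : ContDiff ℝ (⊤ : ℕ∞) fun t => φ (x - t) := hφ.comp (contDiff_const.sub contDiff_id)
    have hcs : HasCompactSupport fun t => φ (x - t) :=
      hc.comp_homeomorph (Homeomorph.subLeft x)
    have := hw i _ hsm hcs
    rw [← neg_eq_iff_eq_neg] at this
    rw [← this, ← integral_neg]
    congr 1
    funext t
    have hd : HasFDerivAt (fun t => φ (x - t)) _ t :=
      ((hφ.differentiable (by simp)) (x - t)).hasFDerivAt.comp t ((hasFDerivAt_id t).const_sub x)
    rw [hd.fderiv]
    simp

lemma integrable_kernel {f g : E2 → ℝ} (hf : Integrable f) (hg : Integrable g) {k : E2 × E2 → ℝ}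
    (hk : Measurable k) {ε : ℝ} (hb : ∀ p, |k p| ≤ ε) :
    Integrable (fun p : E2 × E2 => k p * (f p.1 * g p.2)) (volume.prod volume) :=
  (hf.mul_prod hg).bdd_mul hk.aestronglyMeasurable (.of_forall hb)

lemma ae_fst {P : E2 → Prop} (h : ∀ᵐ x, P x) :
    ∀ᵐ p : E2 × E2 ∂(volume.prod volume), P p.1 :=
  Measure.quasiMeasurePreserving_fst.ae h

lemma ae_snd {P : E2 → Prop} (h : ∀ᵐ x, P x) :
    ∀ᵐ p : E2 × E2 ∂(volume.prod volume), P p.2 :=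
  Measure.quasiMeasurePreserving_snd.ae h

lemma bil_bound (k : E2 × E2 → ℝ) (ε : ℝ) (hb : ∀ p, |k p| ≤ ε)
    (f g : Lp ℝ 1 (volume : Measure E2)) :
    ‖∫ p : E2 × E2, k p * (f p.1 * g p.2) ∂(volume.prod volume)‖ ≤ ε * ‖f‖ * ‖g‖ := by
  rw [L1.norm_eq_integral_norm, L1.norm_eq_integral_norm, mul_assoc,
    ← integral_prod_mul, ← integral_const_mul]
  refine norm_integral_le_of_norm_le
    (((L1.integrable_coeFn f).norm.mul_prod (L1.integrable_coeFn g).norm).const_mul _)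
    (.of_forall fun p => ?_)
  rw [norm_mul, norm_mul]
  gcongr
  exact hb p

/-- The bounded bilinear form on `L¹ × L¹` with bounded kernel `k`. -/
def bil (k : E2 × E2 → ℝ) (hk : Measurable k) (ε : ℝ) (hb : ∀ p, |k p| ≤ ε) :
    Lp ℝ 1 (volume : Measure E2) →L[ℝ] Lp ℝ 1 (volume : Measure E2) →L[ℝ] ℝ :=
  have hi : ∀ f g : Lp ℝ 1 (volume : Measure E2),
      Integrable (fun p : E2 × E2 => k p * (f p.1 * g p.2)) (volume.prod volume) := fun f g =>
    integrable_kernel (L1.integrable_coeFn f) (L1.integrable_coeFn g) hk hb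
  LinearMap.mkContinuous₂
    (LinearMap.mk₂ ℝ (fun f g : Lp ℝ 1 (volume : Measure E2) =>
        ∫ p : E2 × E2, k p * (f p.1 * g p.2) ∂(volume.prod volume))
      (by
        intro f f' g
        rw [← integral_add (hi f g) (hi f' g)]
        apply integral_congr_ae
        filter_upwards [ae_fst (Lp.coeFn_add f f')] with p hp
        rw [hp, Pi.add_apply]; ring)
      (by
        intro c f g
        rw [← integral_smul]
        apply integral_congr_ae
        filter_upwards [ae_fst (Lp.coeFn_smul c f)] with p hp
        rw [hp, Pi.smul_apply]; simp only [smul_eq_mul]; ring)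
      (by
        intro f g g'
        rw [← integral_add (hi f g) (hi f g')]
        apply integral_congr_ae
        filter_upwards [ae_snd (Lp.coeFn_add g g')] with p hp
        rw [hp, Pi.add_apply]; ring)
      (by
        intro c f g
        rw [← integral_smul]
        apply integral_congr_ae
        filter_upwards [ae_snd (Lp.coeFn_smul c g)] with p hp
        rw [hp, Pi.smul_apply]; simp only [smul_eq_mul]; ring)) ε (bil_bound k ε hb)

lemma bil_tr (k : E2 × E2 → ℝ) (hk : Measurable k) (ε : ℝ) (hb : ∀ p, |k p| ≤ ε)
    (F : E2 → ℝ) (hF : Integrable F) (x : E2) :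
    bil k hk ε hb (tr F hF x) (tr F hF x) =
      ∫ p : E2 × E2, k p * (F (x - p.1) * F (x - p.2)) ∂(volume.prod volume) := by
  have : bil k hk ε hb (tr F hF x) (tr F hF x) =
    ∫ p : E2 × E2, k p * (tr F hF x p.1 * tr F hF x p.2) ∂(volume.prod volume) := rfl
  rw [this]
  apply integral_congr_ae
  filter_upwards [ae_fst (tr_coe F hF x), ae_snd (tr_coe F hF x)] with p h1 h2
  rw [h1, h2]

lemma norm_bil (k : E2 × E2 → ℝ) (hk : Measurable k) (ε : ℝ) (hε : 0 ≤ ε)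
    (hb : ∀ p, |k p| ≤ ε) : ‖bil k hk ε hb‖ ≤ ε :=
  LinearMap.mkContinuous₂_norm_le _ hε (bil_bound k ε hb)

lemma deriv_bil (F : E2 → ℝ) (hF : Integrable F) (D : Fin 2 → E2 → ℝ)
    (hD : ∀ i, Integrable (D i)) (hw : ∀ i, IsWeakPartialDeriv i F (D i)) (ε : ℝ) (hε0 : 0 ≤ ε)
    (B : Lp ℝ 1 (volume : Measure E2) →L[ℝ] Lp ℝ 1 (volume : Measure E2) →L[ℝ] ℝ)
    (hn : ‖B‖ ≤ ε) (x : E2) :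
    ∃ L : E2 →L[ℝ] ℝ, HasFDerivAt (fun x => B (tr F hF x) (tr F hF x)) L x ∧
      ‖L‖ ≤ 2 * ε * (∫ y, |F y|) * ∑ i, ∫ y, |D i y| := by
  have hT := hasFDerivAt_tr F hF D hD hw x
  have hd := B.hasFDerivAt_of_bilinear hT hT
  refine ⟨_, hd, ?_⟩
  have hN := norm_trD D hD x
  have hM := norm_tr F hF x
  have hM0 : 0 ≤ ∫ y, |F y| := hM ▸ norm_nonneg _
  have gen : ∀ a b : Lp ℝ 1 (volume : Measure E2), ‖B a b‖ ≤ ε * ‖a‖ * ‖b‖ := fun a b =>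
    (B.le_opNorm₂ a b).trans (by gcongr)
  have hS0 : 0 ≤ ∑ i, ∫ y, |D i y| := (norm_nonneg _).trans hN
  refine ContinuousLinearMap.opNorm_le_bound _ (by positivity) fun v => ?_
  have hv : ‖trD D hD x v‖ ≤ (∑ i, ∫ y, |D i y|) * ‖v‖ :=
    ((trD D hD x).le_opNorm v).trans (by gcongr)
  have g1 := gen (tr F hF x) (trD D hD x v)
  have g2 := gen (trD D hD x v) (tr F hF x)
  rw [add_apply, ContinuousLinearMap.precompR_apply, ContinuousLinearMap.precompL_apply]
  refine (norm_add_le _ _).trans ?_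
  rw [hM] at g1 g2
  calc _ ≤ ε * (∫ y, |F y|) * ((∑ i, ∫ y, |D i y|) * ‖v‖) +
        ε * ((∑ i, ∫ y, |D i y|) * ‖v‖) * (∫ y, |F y|) := by
        refine add_le_add (g1.trans ?_) (g2.trans ?_) <;> gcongr
    _ = _ := by ring

lemma main_abs (F : E2 → ℝ) (hF : Integrable F) (D : Fin 2 → E2 → ℝ)
    (hD : ∀ i, Integrable (D i)) (hw : ∀ i, IsWeakPartialDeriv i F (D i))
    (R : ℝ) (hR : 0 < R) (J : E2 → ℝ) (hJ : Continuous J) (ε : ℝ)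
    (hε : ∀ x ∈ ball (0 : E2) (2 * R), |J x - 1| ≤ ε)
    (u : E2 → ℝ) (hu : Measurable u) (hu1 : ∀ x, u x ∈ Icc (0 : ℝ) 1)
    (hu0 : ∀ x, x ∉ ball (0 : E2) R → u x = 0) (x : E2) :
    ∃ L : E2 →L[ℝ] ℝ, HasFDerivAt (fun x => Pop F J u x - (∫ y, u y * F (x - y)) ^ 2) L x ∧
      ‖L‖ ≤ 2 * ε * (∫ y, |F y|) * ∑ i, ∫ y, |D i y| := by
  have hε0 : 0 ≤ ε := (abs_nonneg _).trans (hε 0 (by simp [hR]))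
  set k : E2 × E2 → ℝ := fun p => u p.1 * (J (p.1 - p.2) - 1) * u p.2 with hk
  have hkm : Measurable k := by
    have : Measurable fun p : E2 × E2 => J (p.1 - p.2) :=
      (hJ.comp (continuous_fst.sub continuous_snd)).measurable
    exact ((hu.comp measurable_fst).mul (this.sub_const 1)).mul (hu.comp measurable_snd)
  have hkb : ∀ p, |k p| ≤ ε := by
    intro p
    by_cases h1 : p.1 ∈ ball (0 : E2) R
    swap
    · simp [hk, hu0 _ h1, hε0]
    by_cases h2 : p.2 ∈ ball (0 : E2) R
    swap
    · simp [hk, hu0 _ h2, hε0]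
    have h3 := hε (p.1 - p.2) (by
      rw [mem_ball_zero_iff] at *
      exact (norm_sub_le _ _).trans_lt (by linarith))
    simp only [hk, abs_mul, abs_of_nonneg (hu1 p.1).1, abs_of_nonneg (hu1 p.2).1]
    have h4 : u p.1 * |J (p.1 - p.2) - 1| ≤ 1 * ε := by
      gcongr
      exact (hu1 _).2
    calc _ ≤ (1 * ε) * 1 := by
          gcongr
          · exact (hu1 _).1
          · exact (hu1 _).2
      _ = ε := by ring
  have hfun : (fun x => Pop F J u x - (∫ y, u y * F (x - y)) ^ 2) =
      fun x => bil k hkm ε hkb (tr F hF x) (tr F hF x) := by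
    funext x
    rw [bil_tr]
    have hf : Integrable fun y => u y * F (x - y) :=
      (hF.comp_sub_left x).bdd_mul (c := 1) hu.aestronglyMeasurable (.of_forall fun y => by
        rw [Real.norm_eq_abs, abs_of_nonneg (hu1 y).1]; exact (hu1 y).2)
    have i1 := integrable_kernel (hF.comp_sub_left x) (hF.comp_sub_left x) hkm hkb
    have i2 := hf.mul_prod hf
    have e1 : (∫ y, u y * F (x - y)) ^ 2 = ∫ p : E2 × E2,
        (u p.1 * F (x - p.1)) * (u p.2 * F (x - p.2)) ∂(volume.prod volume) := by
      rw [sq, ← integral_prod_mul]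
    have e2 : Pop F J u x = ∫ p : E2 × E2, (k p * (F (x - p.1) * F (x - p.2)) +
        (u p.1 * F (x - p.1)) * (u p.2 * F (x - p.2))) ∂(volume.prod volume) := by
      refine Eq.trans ?_ (integral_prod _ (i1.add i2)).symm
      rw [Pop]
      congr 1; funext ξ; congr 1; funext η
      simp only [hk, Pi.add_apply]
      ring
    rw [e2, e1, integral_add i1 i2]
    ring
  rw [hfun]
  exact deriv_bil F hF D hD hw ε hε0 (bil k hkm ε hkb) (norm_bil k hkm ε hε0 hkb) x

lemma integrable_resc {s : ℝ} (hs : 0 < s) {f : E2 → ℝ} (hf : Integrable f) :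
    Integrable (resc s f) :=
  (hf.comp_smul (inv_pos.2 hs).ne').const_mul _

lemma integral_resc {s : ℝ} (hs : 0 < s) (f : E2 → ℝ) :
    ∫ x, resc s f x = ∫ x, f x := by
  unfold resc
  rw [integral_const_mul, Measure.integral_comp_inv_smul]
  rw [finrank_euclideanSpace_fin, smul_eq_mul, abs_of_pos (by positivity)]
  field_simp

lemma weak_resc {s : ℝ} (hs : 0 < s) {f g : E2 → ℝ} {i : Fin 2} (h : IsWeakPartialDeriv i f g) :
    IsWeakPartialDeriv i (resc s f) (fun x => s⁻¹ * resc s g x) := by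
  intro φ hφ hc
  have h1 : ContDiff ℝ (⊤ : ℕ∞) fun x => φ (s • x) := hφ.comp (contDiff_const_smul s)
  have h2 : HasCompactSupport fun x => φ (s • x) :=
    hc.comp_homeomorph (Homeomorph.smulOfNeZero s hs.ne')
  have h3 := h _ h1 h2
  have hd : ∀ y, fderiv ℝ (fun x => φ (s • x)) y (EuclideanSpace.single i 1) =
      s * fderiv ℝ φ (s • y) (EuclideanSpace.single i 1) := by
    intro y
    rw [fderiv_comp_smul]
    simp
  simp_rw [hd] at h3
  rw [← integral_resc hs fun x => f x * _, ← integral_resc hs fun x => g x * _] at h3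
  have hsx : ∀ x : E2, s • s⁻¹ • x = x := fun x => smul_inv_smul₀ hs.ne' x
  simp only [resc, hsx] at h3
  have e1 : ∫ x, resc s f x * fderiv ℝ φ x (EuclideanSpace.single i 1) =
      s⁻¹ * ∫ x, s⁻¹ ^ 2 * (f (s⁻¹ • x) * (s * fderiv ℝ φ x (EuclideanSpace.single i 1))) := by
    rw [← integral_const_mul]
    congr 1; funext x
    simp only [resc]
    field_simp
  rw [e1, h3, mul_neg, ← integral_const_mul]
  congr 2; funext x
  simp only [resc]
  ring

lemma hasFDerivAt_Gauss (x : E2) :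
    HasFDerivAt Gauss (-(Gauss x) • (innerSL ℝ x)) x := by
  have h1 := (((hasStrictFDerivAt_norm_sq x).hasFDerivAt.const_mul (-(1/2 : ℝ))).exp).const_mul
    ((2 * Real.pi)⁻¹)
  have h2 : Gauss = fun y : E2 => (2 * Real.pi)⁻¹ * Real.exp (-(1/2 : ℝ) * ‖y‖ ^ 2) := by
    funext y; simp only [Gauss]; congr 2; ring
  rw [h2]
  refine h1.congr_fderiv ?_
  ext v
  simp
  ring

lemma continuous_Gauss : Continuous Gauss := by unfold Gauss; fun_prop

lemma integrable_gauss_aux {b : ℝ} (hb : 0 < b) :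
    Integrable fun x : E2 => Real.exp (-b * ‖x‖ ^ 2) := by
  have := GaussianFourier.integrable_cexp_neg_mul_sq_norm_add (V := E2) (b := (b : ℂ))
    (by simpa using hb) 0 0
  have := this.norm
  simpa [Complex.norm_exp, ← Complex.ofReal_pow] using this

lemma integrable_Gauss : Integrable Gauss := by
  have := (integrable_gauss_aux (b := 1/2) (by norm_num)).const_mul ((2 * Real.pi)⁻¹)
  refine this.congr (.of_forall fun x => ?_)
  simp only [Gauss]; congr 2; ring

lemma GaussD_eq (i : Fin 2) (x : E2) : GaussD i x = -(Gauss x) * x i := by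
  rw [GaussD, (hasFDerivAt_Gauss x).fderiv]
  simp only [smul_apply, innerSL_apply_apply, smul_eq_mul]
  rw [EuclideanSpace.inner_single_right]
  simp

lemma integrable_GaussD (i : Fin 2) : Integrable (GaussD i) := by
  have := ((integrable_gauss_aux (b := 1/4) (by norm_num)).const_mul ((2 * Real.pi)⁻¹ * 2))
  refine this.mono' ?_ (.of_forall fun x => ?_)
  · have : GaussD i = fun x => -(Gauss x) * x i := funext (GaussD_eq i)
    rw [this]
    have := continuous_Gauss
    exact Continuous.aestronglyMeasurable (by fun_prop)
  · rw [GaussD_eq, norm_mul, norm_neg]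
    have h1 : ‖x i‖ ≤ ‖x‖ := PiLp.norm_apply_le x i
    have h2 : ‖x‖ ≤ 2 * Real.exp (1/4 * ‖x‖ ^ 2) := by
      have := Real.add_one_le_exp (1/4 * ‖x‖ ^ 2)
      nlinarith [sq_nonneg (‖x‖ - 1), sq_nonneg (‖x‖)]
    have h3 : ‖Gauss x‖ = (2 * Real.pi)⁻¹ * Real.exp (-(1/2) * ‖x‖ ^ 2) := by
      rw [Real.norm_eq_abs, abs_of_nonneg (by unfold Gauss; positivity)]
      simp only [Gauss]; congr 2; ring
    rw [h3]
    calc _ ≤ (2 * Real.pi)⁻¹ * Real.exp (-(1/2) * ‖x‖ ^ 2) * (2 * Real.exp (1/4 * ‖x‖ ^ 2)) := by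
          gcongr; exact h1.trans h2
      _ = (2 * Real.pi)⁻¹ * 2 * (Real.exp (-(1/2) * ‖x‖ ^ 2) * Real.exp (1/4 * ‖x‖ ^ 2)) := by ring
      _ = _ := by rw [← Real.exp_add]; congr 2; ring

lemma int_mul_test {f φ : E2 → ℝ} (hf : Integrable f) (hφ : Continuous φ)
    (hc : HasCompactSupport φ) : Integrable fun x => f x * φ x := by
  obtain ⟨M, hM⟩ := hφ.bounded_above_of_compact_support hc
  exact hf.mul_bdd (c := M) hφ.aestronglyMeasurable (.of_forall hM)

lemma int_mul_test' {f φ : E2 → ℝ} (hf : Integrable f) (hφ : ContDiff ℝ (⊤ : ℕ∞) φ)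
    (hc : HasCompactSupport φ) (v : E2) : Integrable fun x => f x * fderiv ℝ φ x v := by
  have h1 : Continuous (fderiv ℝ φ) := hφ.continuous_fderiv (by simp)
  exact int_mul_test hf (by fun_prop) (hc.fderiv_apply ℝ v)

lemma weak_Gauss (i : Fin 2) : IsWeakPartialDeriv i Gauss (GaussD i) := by
  intro φ hφ hc
  exact integral_mul_fderiv_eq_neg_fderiv_mul_of_integrable
    (int_mul_test (integrable_GaussD i) hφ.continuous hc)
    (int_mul_test' integrable_Gauss hφ hc _)
    (int_mul_test integrable_Gauss hφ.continuous hc)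
    (fun x _ => (hasFDerivAt_Gauss x).differentiableAt)
    (fun x _ => hφ.differentiable (by simp) x)

lemma weak_add {i : Fin 2} {f g f' g' : E2 → ℝ} (hf : Integrable f) (hg : Integrable g)
    (hf' : Integrable f') (hg' : Integrable g')
    (h1 : IsWeakPartialDeriv i f f') (h2 : IsWeakPartialDeriv i g g') :
    IsWeakPartialDeriv i (fun x => f x + g x) (fun x => f' x + g' x) := by
  intro φ hφ hc
  simp_rw [add_mul]
  rw [integral_add (int_mul_test' hf hφ hc _) (int_mul_test' hg hφ hc _),
    integral_add (int_mul_test hf' hφ.continuous hc) (int_mul_test hg' hφ.continuous hc),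
    h1 φ hφ hc, h2 φ hφ hc]
  ring

/-- There is an absolute constant `C > 0` such that, for `G̃ = G + ψ` with `ψ ∈ W^{2,1}(ℝ²)`,
continuous `J` with `ε = ‖J - 1‖_{L^∞(B_{2R})}`, `0 < s ≤ 1` and measurable `u : ℝ² → [0,1]`
vanishing outside `B_R`:
`‖∇(𝒫_{J,s}(u) - (u ∗ G̃_s)²)‖_{L^∞} ≤ C ‖G̃‖_{L¹} ‖∇G̃‖_{L¹} ε / s`. -/
theorem stmt15 :
    ∃ C : ℝ, 0 < C ∧
      ∀ (R : ℝ), 0 < R →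
      ∀ (ψ : E2 → ℝ) (ψ' : Fin 2 → E2 → ℝ) (ψ'' : Fin 2 → Fin 2 → E2 → ℝ),
        Integrable ψ →
        (∀ i, IsWeakPartialDeriv i ψ (ψ' i) ∧ Integrable (ψ' i)) →
        (∀ i j, IsWeakPartialDeriv j (ψ' i) (ψ'' i j) ∧ Integrable (ψ'' i j)) →
      ∀ (J : E2 → ℝ), Continuous J →
      ∀ (s : ℝ), 0 < s → s ≤ 1 →
      ∀ (ε : ℝ), (∀ x ∈ ball (0 : E2) (2 * R), |J x - 1| ≤ ε) →
      ∀ (u : E2 → ℝ), Measurable u → (∀ x, u x ∈ Icc (0 : ℝ) 1) →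
        (∀ x, x ∉ ball (0 : E2) R → u x = 0) →
        Differentiable ℝ
          (fun x => Pop (resc s fun z => Gauss z + ψ z) J u x -
            (∫ y, u y * resc s (fun z => Gauss z + ψ z) (x - y)) ^ 2) ∧
        ∀ x : E2,
          ‖fderiv ℝ
              (fun x => Pop (resc s fun z => Gauss z + ψ z) J u x -
                (∫ y, u y * resc s (fun z => Gauss z + ψ z) (x - y)) ^ 2) x‖ ≤
            C * (∫ y, |Gauss y + ψ y|) *
              (∑ i, ∫ y, |GaussD i y + ψ' i y|) * ε / s := by
  refine ⟨2, two_pos, ?_⟩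
  intro R hR ψ ψ' ψ'' hψ hψ' _ J hJ s hs _ ε hε u hu hu1 hu0
  have hF0 : Integrable fun z => Gauss z + ψ z := integrable_Gauss.add hψ
  have hD0 : ∀ i, Integrable fun z => GaussD i z + ψ' i z := fun i =>
    (integrable_GaussD i).add (hψ' i).2
  have hw0 : ∀ i, IsWeakPartialDeriv i (fun z => Gauss z + ψ z)
      (fun z => GaussD i z + ψ' i z) := fun i =>
    weak_add integrable_Gauss hψ (integrable_GaussD i) (hψ' i).2 (weak_Gauss i) (hψ' i).1
  have main := main_abs (resc s fun z => Gauss z + ψ z) (integrable_resc hs hF0)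
    (fun i x => s⁻¹ * resc s (fun z => GaussD i z + ψ' i z) x)
    (fun i => (integrable_resc hs (hD0 i)).const_mul _) (fun i => weak_resc hs (hw0 i))
    R hR J hJ ε hε u hu hu1 hu0
  have habs : ∀ f : E2 → ℝ, ∫ y, |resc s f y| = ∫ y, |f y| := by
    intro f
    rw [← integral_resc hs fun y => |f y|]
    congr 1; funext y
    simp only [resc, abs_mul, abs_pow, abs_of_pos (inv_pos.2 hs)]
  refine ⟨fun x => ?_, fun x => ?_⟩
  · obtain ⟨L, hL, -⟩ := main x
    exact hL.differentiableAt
  · obtain ⟨L, hL, hn⟩ := main x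
    rw [hL.fderiv]
    refine hn.trans (le_of_eq ?_)
    simp_rw [abs_mul, abs_of_pos (inv_pos.2 hs), integral_const_mul, habs]
    rw [← Finset.mul_sum]
    field_simp
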